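/- For the training loss f of a deep linear network, suppose θ ∈ ℝ^d lies on a gradient flow trajectory of f emanating from some point θ_s ∈ ℝ^d with ‖θ_s‖₂ ≤ ε, where ε ∈ (0, 1/(2n)]. Then λ_min(∇²f(θ)) ≥ −(n−1)·√(min{d_0, d_n})·‖∇φ(W_{n:1})‖_F·‖W_{n:1}‖_spectral^{1−2/n} − c·ε^{1−2/n}, where c := (4n(n−1)/(4n)^{2/n})·√(min{d_0, d_n})·‖∇φ(W_{n:1})‖_F · max{1, max_{j∈{1,…,n}} ‖W_j‖_spectral}^{2(n−2)}. -/

import Mathlib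

open scoped RealInnerProductSpace
open Matrix

noncomputable section

/-- The family of weight matrices of a depth-`n` fully connected network with layer widths
`dims 0, dims 1, …, dims n`: `W j` maps `ℝ^{dims j}` to `ℝ^{dims (j+1)}` (zero-indexed). -/
abbrev WeightFam (n : ℕ) (dims : ℕ → ℕ) : Type :=
  ∀ j : Fin n, Matrix (Fin (dims (j.val + 1))) (Fin (dims j.val)) ℝ

/-- Rectangular matrix with ones on the diagonal: equals the identity matrix whenever the
two dimensions coincide. -/
def castId (p q : ℕ) : Matrix (Fin p) (Fin q) ℝ :=
  Matrix.of fun i j => if (i : ℕ) = (j : ℕ) then 1 else 0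

/-- `segProd dims W a b = W_{b-1} * ⋯ * W_a` (zero-indexed), the identity when `a = b`.
This realizes the paper's product `W_{b : a+1}` (one-indexed), empty products being
identity matrices. -/
def segProd {n : ℕ} (dims : ℕ → ℕ) (W : WeightFam n dims) (a : ℕ) :
    (b : ℕ) → Matrix (Fin (dims b)) (Fin (dims a)) ℝ
  | 0 => castId (dims 0) (dims a)
  | b + 1 =>
      if a = b + 1 then castId (dims (b + 1)) (dims a)
      else if hb : b < n then W ⟨b, hb⟩ * segProd dims W a b else 0

/-- Multiplication of a Euclidean vector by a matrix. -/
def mulVecE {p q : ℕ} (M : Matrix (Fin p) (Fin q) ℝ) (v : EuclideanSpace ℝ (Fin q)) :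
    EuclideanSpace ℝ (Fin p) :=
  (EuclideanSpace.equiv (Fin p) ℝ).symm (M.mulVec (EuclideanSpace.equiv (Fin q) ℝ v))

/-- The space of `p × q` real matrices regarded as a Euclidean space (so that the Euclidean
norm is the Frobenius norm). -/
abbrev MatE (p q : ℕ) : Type := EuclideanSpace ℝ (Fin p × Fin q)

/-- Conversion from the Euclidean representation to the matrix itself. -/
def toMat {p q : ℕ} (w : MatE p q) : Matrix (Fin p) (Fin q) ℝ :=
  Matrix.of fun i j => w (i, j)

/-- Conversion from a matrix to its Euclidean representation. -/
def ofMat {p q : ℕ} (M : Matrix (Fin p) (Fin q) ℝ) : MatE p q :=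
  (EuclideanSpace.equiv (Fin p × Fin q) ℝ).symm fun ij => M ij.1 ij.2

/-- The Hessian of `f` at `x`, regarded as a quadratic form, evaluated at `v`. -/
def hessQ {E : Type*} [NormedAddCommGroup E] [InnerProductSpace ℝ E] [CompleteSpace E]
    (f : E → ℝ) (x v : E) : ℝ :=
  ⟪v, fderiv ℝ (gradient f) x v⟫

/-- `φ(W) = (1/|S|) ∑ᵢ ℓ(W xᵢ, yᵢ)`, as a function of the Euclidean representation of the
matrix `W`. -/
def phiE {Y : Type*} {s : ℕ} (n : ℕ) (dims : ℕ → ℕ)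
    (loss : EuclideanSpace ℝ (Fin (dims n)) → Y → ℝ)
    (x : Fin s → EuclideanSpace ℝ (Fin (dims 0))) (y : Fin s → Y)
    (w : MatE (dims n) (dims 0)) : ℝ :=
  (1 / (s : ℝ)) * ∑ i, loss (mulVecE (toMat w) (x i)) (y i)

/-- The training loss of the deep linear network: `f θ = φ (W_{n:1})`. -/
def linLoss {Y : Type*} {s : ℕ} {n d : ℕ} (dims : ℕ → ℕ)
    (loss : EuclideanSpace ℝ (Fin (dims n)) → Y → ℝ)
    (x : Fin s → EuclideanSpace ℝ (Fin (dims 0))) (y : Fin s → Y)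
    (arr : EuclideanSpace ℝ (Fin d) →ₗ[ℝ] WeightFam n dims)
    (θ : EuclideanSpace ℝ (Fin d)) : ℝ :=
  phiE n dims loss x y (ofMat (segProd dims (arr θ) 0 n))

/-- Spectral norm of a matrix (largest singular value), i.e. the operator norm with respect
to Euclidean norms. -/
def specNorm {p q : ℕ} (M : Matrix (Fin p) (Fin q) ℝ) : ℝ :=
  sSup {r : ℝ | ∃ v : EuclideanSpace ℝ (Fin q), ‖v‖ = 1 ∧ r = ‖mulVecE M v‖}

section MatrixNorms

variable {p q r : ℕ}

section L2

open scoped Matrix.Norms.L2Operator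

lemma specNorm_eq_l2_opNorm (M : Matrix (Fin p) (Fin q) ℝ) : specNorm M = ‖M‖ := by
  let f := LinearMap.toContinuousLinearMap (Matrix.toEuclideanLin M)
  change specNorm M = ‖f‖
  have hfv : ∀ v, mulVecE M v = f v := fun v => rfl
  rcases isEmpty_or_nonempty (Fin q) with hq | hq
  · have h0 : f = 0 := by
      ext v
      rw [Subsingleton.elim v 0, map_zero, _root_.zero_apply]
    have hs : {r : ℝ | ∃ v : EuclideanSpace ℝ (Fin q), ‖v‖ = 1 ∧ r = ‖mulVecE M v‖} = ∅ := by
      ext r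
      simp only [Set.mem_ofPred_eq, Set.mem_empty_iff_false, iff_false]
      rintro ⟨v, hv, -⟩
      rw [Subsingleton.elim v 0, norm_zero] at hv
      exact zero_ne_one hv
    rw [specNorm, hs, h0, Real.sSup_empty, norm_zero]
  · rw [← f.sSup_sphere_eq_norm, specNorm]
    congr 1
    ext r
    simp only [Set.mem_ofPred_eq, Set.mem_image, mem_sphere_iff_norm, sub_zero, hfv]
    exact ⟨fun ⟨v, hv, h⟩ => ⟨v, hv, h.symm⟩, fun ⟨v, hv, h⟩ => ⟨v, hv, h.symm⟩⟩

lemma specNorm_nonneg (M : Matrix (Fin p) (Fin q) ℝ) : 0 ≤ specNorm M := by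
  rw [specNorm_eq_l2_opNorm]; exact norm_nonneg M

lemma specNorm_mul_le (A : Matrix (Fin p) (Fin q) ℝ) (B : Matrix (Fin q) (Fin r) ℝ) :
    specNorm (A * B) ≤ specNorm A * specNorm B := by
  simpa only [specNorm_eq_l2_opNorm] using Matrix.l2_opNorm_mul A B

lemma specNorm_transpose (M : Matrix (Fin p) (Fin q) ℝ) : specNorm Mᵀ = specNorm M := by
  simpa only [specNorm_eq_l2_opNorm, Matrix.conjTranspose_eq_transpose_of_trivial] using
    Matrix.l2_opNorm_conjTranspose M

lemma dotProduct_self_eq_norm_sq (u : Fin p → ℝ) : u ⬝ᵥ u = ‖WithLp.toLp 2 u‖ ^ 2 := by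
  rw [EuclideanSpace.norm_sq_eq]
  simp [dotProduct, sq]

lemma dotProduct_mulVec_self_le (M : Matrix (Fin p) (Fin q) ℝ) (u : Fin q → ℝ) :
    (M *ᵥ u) ⬝ᵥ (M *ᵥ u) ≤ specNorm M ^ 2 * (u ⬝ᵥ u) := by
  rw [dotProduct_self_eq_norm_sq, dotProduct_self_eq_norm_sq, ← mul_pow, specNorm_eq_l2_opNorm]
  exact pow_le_pow_left₀ (norm_nonneg _) (Matrix.l2_opNorm_mulVec M (WithLp.toLp 2 u)) 2

lemma specNorm_sq_le {M : Matrix (Fin p) (Fin q) ℝ} {K : ℝ} (hK : 0 ≤ K)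
    (h : ∀ u : Fin q → ℝ, (M *ᵥ u) ⬝ᵥ (M *ᵥ u) ≤ K * (u ⬝ᵥ u)) : specNorm M ^ 2 ≤ K := by
  have : specNorm M ≤ √K := by
    rw [specNorm_eq_l2_opNorm, Matrix.l2_opNorm_def]
    refine ContinuousLinearMap.opNorm_le_bound _ (Real.sqrt_nonneg K) fun v => ?_
    refine le_of_sq_le_sq ?_ (by positivity)
    have hv := h (WithLp.ofLp v)
    rw [dotProduct_self_eq_norm_sq, dotProduct_self_eq_norm_sq] at hv
    rw [mul_pow, Real.sq_sqrt hK]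
    exact hv
  calc specNorm M ^ 2 ≤ √K ^ 2 := pow_le_pow_left₀ (specNorm_nonneg M) this 2
    _ = K := Real.sq_sqrt hK

end L2

lemma specNorm_one_le : specNorm (1 : Matrix (Fin p) (Fin p) ℝ) ≤ 1 := by
  have := specNorm_sq_le (M := (1 : Matrix (Fin p) (Fin p) ℝ)) zero_le_one fun u => by
    rw [Matrix.one_mulVec, one_mul]
  nlinarith [specNorm_nonneg (1 : Matrix (Fin p) (Fin p) ℝ)]

lemma norm_ofMat_sq (M : Matrix (Fin p) (Fin q) ℝ) :
    ‖ofMat M‖ ^ 2 = ∑ i, ∑ j, M i j ^ 2 := by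
  simp [EuclideanSpace.norm_sq_eq, ofMat, Fintype.sum_prod_type]

lemma norm_ofMat_transpose (M : Matrix (Fin p) (Fin q) ℝ) : ‖ofMat Mᵀ‖ = ‖ofMat M‖ := by
  rw [← sq_eq_sq₀ (norm_nonneg _) (norm_nonneg _), norm_ofMat_sq, norm_ofMat_sq, Finset.sum_comm]
  rfl

lemma ofMat_add (A B : Matrix (Fin p) (Fin q) ℝ) : ofMat (A + B) = ofMat A + ofMat B := rfl

lemma ofMat_zero : ofMat (0 : Matrix (Fin p) (Fin q) ℝ) = 0 := rfl

lemma norm_ofMat_mul_le_specNorm_mul (A : Matrix (Fin p) (Fin q) ℝ)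
    (B : Matrix (Fin q) (Fin r) ℝ) : ‖ofMat (A * B)‖ ≤ specNorm A * ‖ofMat B‖ := by
  refine le_of_sq_le_sq ?_ (mul_nonneg (specNorm_nonneg A) (norm_nonneg _))
  rw [mul_pow, norm_ofMat_sq, norm_ofMat_sq, Finset.sum_comm,
    Finset.sum_comm (f := fun i j => B i j ^ 2), Finset.mul_sum]
  refine Finset.sum_le_sum fun k _ => ?_
  have := dotProduct_mulVec_self_le A (fun j => B j k)
  simpa only [dotProduct, Matrix.mulVec, Matrix.mul_apply, sq] using this

lemma norm_ofMat_mul_le_mul_specNorm (A : Matrix (Fin p) (Fin q) ℝ)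
    (B : Matrix (Fin q) (Fin r) ℝ) : ‖ofMat (A * B)‖ ≤ ‖ofMat A‖ * specNorm B := by
  rw [← norm_ofMat_transpose, Matrix.transpose_mul, mul_comm, ← specNorm_transpose B,
    ← norm_ofMat_transpose A]
  exact norm_ofMat_mul_le_specNorm_mul _ _

lemma specNorm_le_norm_ofMat (M : Matrix (Fin p) (Fin q) ℝ) : specNorm M ≤ ‖ofMat M‖ := by
  refine le_of_sq_le_sq (specNorm_sq_le (by positivity) fun u => ?_) (norm_nonneg _)
  rw [norm_ofMat_sq, Finset.sum_mul, dotProduct]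
  refine Finset.sum_le_sum fun i _ => ?_
  rw [← sq]
  simpa only [dotProduct, Matrix.mulVec, sq] using
    Finset.sum_mul_sq_le_sq_mul_sq Finset.univ (M i) u

lemma norm_ofMat_mul_le (A : Matrix (Fin p) (Fin q) ℝ) (B : Matrix (Fin q) (Fin r) ℝ) :
    ‖ofMat (A * B)‖ ≤ ‖ofMat A‖ * ‖ofMat B‖ :=
  (norm_ofMat_mul_le_specNorm_mul A B).trans
    (mul_le_mul_of_nonneg_right (specNorm_le_norm_ofMat A) (norm_nonneg _))

end MatrixNorms

section EndToEnd

variable {dims : ℕ → ℕ}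

/-- A sequence of composable weight matrices, indexed by all natural numbers. -/
abbrev WeightSeq (dims : ℕ → ℕ) : Type :=
  ∀ j : ℕ, Matrix (Fin (dims (j + 1))) (Fin (dims j)) ℝ

/-- Extension of a finite family of weight matrices by zero matrices. -/
def extendFam {n : ℕ} (W : WeightFam n dims) : WeightSeq dims :=
  fun j => if h : j < n then W ⟨j, h⟩ else 0

/-- The product `W (b - 1) * ⋯ * W 0`. -/
def prodTo (W : WeightSeq dims) : ∀ b : ℕ, Matrix (Fin (dims b)) (Fin (dims 0)) ℝ
  | 0 => 1
  | b + 1 => W b * prodTo W b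

/-- The coefficient of `t` in `prodTo (W + t • V) b`. -/
def prodLin (W V : WeightSeq dims) : ∀ b : ℕ, Matrix (Fin (dims b)) (Fin (dims 0)) ℝ
  | 0 => 0
  | b + 1 => W b * prodLin W V b + V b * prodTo W b

/-- The coefficient of `t ^ 2` in `prodTo (W + t • V) b`. -/
def prodQuad (W V : WeightSeq dims) : ∀ b : ℕ, Matrix (Fin (dims b)) (Fin (dims 0)) ℝ
  | 0 => 0
  | b + 1 => W b * prodQuad W V b + V b * prodLin W V b

lemma extendFam_of_lt {n : ℕ} (W : WeightFam n dims) {j : ℕ} (h : j < n) :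
    extendFam W j = W ⟨j, h⟩ := dif_pos h

lemma extendFam_of_not_lt {n : ℕ} (W : WeightFam n dims) {j : ℕ} (h : ¬ j < n) :
    extendFam W j = 0 := dif_neg h

lemma extendFam_add_smul {n : ℕ} (W V : WeightFam n dims) (t : ℝ) :
    extendFam (W + t • V) = extendFam W + t • extendFam V := by
  funext j
  by_cases h : j < n <;> simp [extendFam, h]

lemma segProd_zero_eq_prodTo {n : ℕ} (W : WeightFam n dims) (b : ℕ) :
    segProd dims W 0 b = prodTo (extendFam W) b := by
  induction b with
  | zero =>
    ext i j
    simp [segProd, prodTo, castId, Matrix.one_apply, Fin.ext_iff]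
  | succ b ih =>
    rw [segProd, if_neg (Nat.succ_ne_zero b).symm, prodTo, ih]
    by_cases h : b < n <;> simp [extendFam, h]

lemma hasDerivAt_mul_apply {p q r : ℕ} {A A' : ℝ → Matrix (Fin p) (Fin q) ℝ}
    {B B' : ℝ → Matrix (Fin q) (Fin r) ℝ} {t : ℝ}
    (hA : ∀ i j, HasDerivAt (fun s => A s i j) (A' t i j) t)
    (hB : ∀ i j, HasDerivAt (fun s => B s i j) (B' t i j) t) (i : Fin p) (j : Fin r) :
    HasDerivAt (fun s => (A s * B s) i j) ((A' t * B t + A t * B' t) i j) t := by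
  simp only [Matrix.mul_apply, Matrix.add_apply, ← Finset.sum_add_distrib]
  exact HasDerivAt.fun_sum fun k _ => (hA i k).mul (hB k j)

lemma hasDerivAt_add_smul_apply (W V : WeightSeq dims) (t : ℝ) (b : ℕ)
    (i : Fin (dims (b + 1))) (j : Fin (dims b)) :
    HasDerivAt (fun s : ℝ => (W + s • V) b i j) (V b i j) t := by
  simpa using ((hasDerivAt_id t).mul_const (V b i j)).const_add (W b i j)

lemma hasDerivAt_prodTo (W V : WeightSeq dims) (t : ℝ) (b : ℕ) (i : Fin (dims b))
    (j : Fin (dims 0)) :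
    HasDerivAt (fun s : ℝ => prodTo (W + s • V) b i j) (prodLin (W + t • V) V b i j) t := by
  induction b generalizing j with
  | zero => simpa [prodTo, prodLin] using hasDerivAt_const t ((1 : Matrix _ _ ℝ) i j)
  | succ b ih =>
    have := hasDerivAt_mul_apply (A := fun s : ℝ => (W + s • V) b) (A' := fun _ => V b)
      (B' := fun s => prodLin (W + s • V) V b) (hasDerivAt_add_smul_apply W V t b) ih i j
    exact this.congr_deriv (add_comm _ _)

lemma hasDerivAt_prodLin (W V : WeightSeq dims) (t : ℝ) (b : ℕ) (i : Fin (dims b))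
    (j : Fin (dims 0)) :
    HasDerivAt (fun s : ℝ => prodLin (W + s • V) V b i j)
      (2 * prodQuad (W + t • V) V b i j) t := by
  induction b generalizing j with
  | zero => simpa [prodLin, prodQuad] using hasDerivAt_const t (0 : ℝ)
  | succ b ih =>
    have h₁ := hasDerivAt_mul_apply (A := fun s : ℝ => (W + s • V) b) (A' := fun _ => V b)
      (B := fun s => prodLin (W + s • V) V b)
      (B' := fun s => (2 : ℝ) • prodQuad (W + s • V) V b)
      (hasDerivAt_add_smul_apply W V t b) (by simpa using ih) i j
    have h₂ := hasDerivAt_mul_apply (A := fun _ : ℝ => V b) (A' := fun _ => 0)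
      (B := fun s => prodTo (W + s • V) b) (B' := fun s => prodLin (W + s • V) V b)
      (fun _ _ => hasDerivAt_const t _) (hasDerivAt_prodTo W V t b) i j
    refine (h₁.add h₂).congr_deriv ?_
    simp only [prodQuad, Matrix.add_apply, Matrix.mul_smul, Matrix.smul_apply, smul_eq_mul,
      Matrix.zero_mul, Matrix.zero_apply]
    ring

lemma specNorm_prodTo_le {W : WeightSeq dims} {a : ℝ} (ha : ∀ j, specNorm (W j) ≤ a) (b : ℕ) :
    specNorm (prodTo W b) ≤ a ^ b := by
  induction b with
  | zero => simpa [prodTo] using specNorm_one_le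
  | succ b ih =>
    rw [pow_succ', prodTo]
    exact (specNorm_mul_le _ _).trans
      (mul_le_mul (ha b) ih (specNorm_nonneg _) ((specNorm_nonneg _).trans (ha b)))

lemma norm_prodLin_le {W : WeightSeq dims} {a : ℝ} (ha : ∀ j, specNorm (W j) ≤ a)
    (V : WeightSeq dims) (b : ℕ) :
    ‖ofMat (prodLin W V b)‖ ≤ a ^ (b - 1) * ∑ j ∈ Finset.range b, ‖ofMat (V j)‖ := by
  have ha0 : 0 ≤ a := (specNorm_nonneg _).trans (ha 0)
  induction b with
  | zero => simp [prodLin, ofMat_zero]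
  | succ b ih =>
    rw [prodLin, ofMat_add, Finset.sum_range_succ, mul_add, Nat.add_sub_cancel]
    refine (norm_add_le _ _).trans (add_le_add ?_ ?_)
    · refine (norm_ofMat_mul_le_specNorm_mul _ _).trans
        ((mul_le_mul (ha b) ih (norm_nonneg _) ha0).trans_eq ?_)
      rcases b with _ | b
      · simp
      · rw [Nat.add_sub_cancel, pow_succ']; ring
    · rw [mul_comm]
      exact (norm_ofMat_mul_le_mul_specNorm _ _).trans
        (mul_le_mul_of_nonneg_left (specNorm_prodTo_le ha b) (norm_nonneg _))

lemma two_mul_norm_prodQuad_le {W : WeightSeq dims} {a : ℝ} (ha : ∀ j, specNorm (W j) ≤ a)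
    (V : WeightSeq dims) (b : ℕ) :
    2 * ‖ofMat (prodQuad W V b)‖ ≤ a ^ (b - 2) *
      ((∑ j ∈ Finset.range b, ‖ofMat (V j)‖) ^ 2 - ∑ j ∈ Finset.range b, ‖ofMat (V j)‖ ^ 2) := by
  have ha0 : 0 ≤ a := (specNorm_nonneg _).trans (ha 0)
  induction b with
  | zero => simp [prodQuad, ofMat_zero]
  | succ b ih =>
    rw [prodQuad, ofMat_add, Finset.sum_range_succ, Finset.sum_range_succ]
    have h₁ := norm_ofMat_mul_le_specNorm_mul (W b) (prodQuad W V b)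
    have h₂ := norm_ofMat_mul_le (V b) (prodLin W V b)
    have h₃ := norm_add_le (ofMat (W b * prodQuad W V b)) (ofMat (V b * prodLin W V b))
    have h₄ := mul_le_mul_of_nonneg_left (norm_prodLin_le ha V b) (norm_nonneg (ofMat (V b)))
    have h₅ := mul_le_mul_of_nonneg_right (ha b) (norm_nonneg (ofMat (prodQuad W V b)))
    have h₆ := mul_le_mul_of_nonneg_left ih ha0
    have h₇ : a * (a ^ (b - 2) * ((∑ j ∈ Finset.range b, ‖ofMat (V j)‖) ^ 2 -
        ∑ j ∈ Finset.range b, ‖ofMat (V j)‖ ^ 2)) = a ^ (b - 1) *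
        ((∑ j ∈ Finset.range b, ‖ofMat (V j)‖) ^ 2 -
        ∑ j ∈ Finset.range b, ‖ofMat (V j)‖ ^ 2) := by
      rcases b with _ | _ | b
      · simp
      · simp
      · rw [show b + 1 + 1 - 2 = b by omega, show b + 1 + 1 - 1 = b + 1 by omega, pow_succ']
        ring
    rw [show b + 1 - 2 = b - 1 by omega]
    linarith

lemma two_mul_norm_prodQuad_le_sum_sq {W : WeightSeq dims} {a : ℝ}
    (ha : ∀ j, specNorm (W j) ≤ a) (V : WeightSeq dims) (b : ℕ) :
    2 * ‖ofMat (prodQuad W V b)‖ ≤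
      a ^ (b - 2) * (((b : ℝ) - 1) * ∑ j ∈ Finset.range b, ‖ofMat (V j)‖ ^ 2) := by
  have ha0 : 0 ≤ a := (specNorm_nonneg _).trans (ha 0)
  refine (two_mul_norm_prodQuad_le ha V b).trans
    (mul_le_mul_of_nonneg_left ?_ (pow_nonneg ha0 _))
  have := sq_sum_le_card_mul_sum_sq (s := Finset.range b) (f := fun j => ‖ofMat (V j)‖)
  rw [Finset.card_range] at this
  linarith

/-- The end-to-end product is stationary along the infinitesimal action of change of basis
in the hidden layers. -/
lemma prodLin_conj (W : WeightSeq dims) (A : ∀ j : ℕ, Matrix (Fin (dims j)) (Fin (dims j)) ℝ)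
    (b : ℕ) :
    prodLin W (fun j => W j * A j - A (j + 1) * W j) b = prodTo W b * A 0 - A b * prodTo W b := by
  induction b with
  | zero => simp [prodLin, prodTo]
  | succ b ih =>
    rw [prodLin, ih, prodTo]
    simp only [Matrix.mul_sub, Matrix.sub_mul, Matrix.mul_assoc]
    abel

end EndToEnd

section Balanced

variable {dims : ℕ → ℕ}

/-- Consecutive layers are balanced up to `δ`: the quadratic forms of `W (k + 1)ᵀ * W (k + 1)` and
`W k * (W k)ᵀ` differ by at most `δ` on unit vectors, for all hidden layers of a network of
depth `n`. -/
def IsBalanced (n : ℕ) (W : WeightSeq dims) (δ : ℝ) : Prop :=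
  ∀ k, k + 1 < n → ∀ u : Fin (dims (k + 1)) → ℝ,
    |(W (k + 1) *ᵥ u) ⬝ᵥ (W (k + 1) *ᵥ u) - ((W k)ᵀ *ᵥ u) ⬝ᵥ ((W k)ᵀ *ᵥ u)| ≤ δ * (u ⬝ᵥ u)

lemma dotProduct_self_nonneg_real {p : ℕ} (u : Fin p → ℝ) : 0 ≤ u ⬝ᵥ u :=
  Finset.sum_nonneg fun i _ => mul_self_nonneg (u i)

lemma dotProduct_mulVec_self_sq_le {p q : ℕ} (M : Matrix (Fin p) (Fin q) ℝ) (u : Fin q → ℝ) :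
    ((M *ᵥ u) ⬝ᵥ (M *ᵥ u)) ^ 2 ≤ ((Mᵀ *ᵥ (M *ᵥ u)) ⬝ᵥ (Mᵀ *ᵥ (M *ᵥ u))) * (u ⬝ᵥ u) := by
  have h : (M *ᵥ u) ⬝ᵥ (M *ᵥ u) = (Mᵀ *ᵥ (M *ᵥ u)) ⬝ᵥ u := by
    rw [Matrix.mulVec_transpose, Matrix.dotProduct_mulVec]
  rw [h]
  simpa only [dotProduct, sq] using
    Finset.sum_mul_sq_le_sq_mul_sq Finset.univ (Mᵀ *ᵥ (M *ᵥ u)) u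

variable {n : ℕ} {W : WeightSeq dims} {δ : ℝ}

lemma IsBalanced.specNorm_sq_succ_le (h : IsBalanced n W δ) (hδ : 0 ≤ δ) {k : ℕ} (hk : k + 1 < n) :
    specNorm (W (k + 1)) ^ 2 ≤ specNorm (W k) ^ 2 + δ := by
  refine specNorm_sq_le (by positivity) fun u => ?_
  have h₁ := (abs_le.1 (h k hk u)).2
  have h₂ := dotProduct_mulVec_self_le (W k)ᵀ u
  rw [specNorm_transpose] at h₂
  linarith

lemma IsBalanced.specNorm_sq_le_first (h : IsBalanced n W δ) (hδ : 0 ≤ δ) {k : ℕ} (hk : k < n) :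
    specNorm (W k) ^ 2 ≤ specNorm (W 0) ^ 2 + k * δ := by
  induction k with
  | zero => simp
  | succ k ih =>
    have := h.specNorm_sq_succ_le hδ hk
    have := ih (by omega)
    push_cast
    linarith

/-- The growth rate of `‖prodTo W k *ᵥ v‖ ^ 2` decreases by at most `δ` per layer. -/
lemma IsBalanced.le_dotProduct_prodTo_succ (h : IsBalanced n W δ) {v : Fin (dims 0) → ℝ} {ρ : ℝ}
    (hρ : ρ * (v ⬝ᵥ v) ≤ (W 0 *ᵥ v) ⬝ᵥ (W 0 *ᵥ v)) {k : ℕ} (hk : k < n) :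
    (ρ - k * δ) * ((prodTo W k *ᵥ v) ⬝ᵥ (prodTo W k *ᵥ v)) ≤
      (prodTo W (k + 1) *ᵥ v) ⬝ᵥ (prodTo W (k + 1) *ᵥ v) := by
  induction k with
  | zero => simpa [prodTo] using hρ
  | succ k ih =>
    have ih := ih (by omega)
    have hb := (abs_le.1 (h k hk (prodTo W (k + 1) *ᵥ v))).1
    have hcs := dotProduct_mulVec_self_sq_le (W k) (prodTo W k *ᵥ v)
    have e₁ : W k *ᵥ (prodTo W k *ᵥ v) = prodTo W (k + 1) *ᵥ v :=
      Matrix.mulVec_mulVec _ _ _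
    have e₂ : W (k + 1) *ᵥ (prodTo W (k + 1) *ᵥ v) = prodTo W (k + 1 + 1) *ᵥ v :=
      Matrix.mulVec_mulVec _ _ _
    rw [e₁] at hcs
    rw [e₂] at hb
    set X := ((W k)ᵀ *ᵥ (prodTo W (k + 1) *ᵥ v)) ⬝ᵥ ((W k)ᵀ *ᵥ (prodTo W (k + 1) *ᵥ v))
    set q₀ := (prodTo W k *ᵥ v) ⬝ᵥ (prodTo W k *ᵥ v) with hq₀
    set q₁ := (prodTo W (k + 1) *ᵥ v) ⬝ᵥ (prodTo W (k + 1) *ᵥ v) with hq₁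
    have hq₁0 : 0 ≤ q₁ := dotProduct_self_nonneg_real _
    have hX0 : 0 ≤ X := dotProduct_self_nonneg_real _
    have hX : (ρ - k * δ) * q₁ ≤ X := by
      rcases (dotProduct_self_nonneg_real (prodTo W k *ᵥ v)).eq_or_lt' with h0 | h0
      · have : q₁ = 0 := by
          rw [hq₀, h0, mul_zero] at hcs
          exact pow_eq_zero_iff two_ne_zero |>.1 (le_antisymm hcs (sq_nonneg _))
        rw [this, mul_zero]
        exact hX0
      · refine le_of_mul_le_mul_right ?_ h0
        nlinarith
    push_cast
    linarith

lemma IsBalanced.pow_mul_le_dotProduct_prodTo (h : IsBalanced n W δ) (hδ : 0 ≤ δ)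
    {v : Fin (dims 0) → ℝ} {ρ : ℝ} (hρ : ρ * (v ⬝ᵥ v) ≤ (W 0 *ᵥ v) ⬝ᵥ (W 0 *ᵥ v))
    (hρn : n * δ ≤ ρ) {k : ℕ} (hk : k ≤ n) :
    (ρ - n * δ) ^ k * (v ⬝ᵥ v) ≤ (prodTo W k *ᵥ v) ⬝ᵥ (prodTo W k *ᵥ v) := by
  induction k with
  | zero => simp [prodTo]
  | succ k ih =>
    have h₁ := h.le_dotProduct_prodTo_succ hρ (k := k) (by omega)
    have h₂ := mul_le_mul_of_nonneg_left (ih (by omega)) (sub_nonneg.2 hρn)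
    have h₃ : (k : ℝ) * δ ≤ n * δ :=
      mul_le_mul_of_nonneg_right (by exact_mod_cast (by omega : k ≤ n)) hδ
    have h₄ := mul_le_mul_of_nonneg_right (sub_le_sub_left h₃ ρ)
      (dotProduct_self_nonneg_real (prodTo W k *ᵥ v))
    rw [pow_succ', mul_assoc]
    linarith

/-- If the end-to-end matrix has squared spectral norm at most `R ^ n`, then every layer has squared
spectral norm at most `R`, up to a multiple of the balancedness defect. -/
lemma IsBalanced.specNorm_sq_le_add (h : IsBalanced n W δ) (hδ : 0 ≤ δ) (hn : n ≠ 0) {R : ℝ}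
    (hR0 : 0 ≤ R) (hR : specNorm (prodTo W n) ^ 2 ≤ R ^ n) {k : ℕ} (hk : k < n) :
    specNorm (W k) ^ 2 ≤ R + 2 * n * δ := by
  have h0 : specNorm (W 0) ^ 2 ≤ R + n * δ := by
    refine specNorm_sq_le (by positivity) fun v => ?_
    rcases (dotProduct_self_nonneg_real v).eq_or_lt' with hv | hv
    · have := dotProduct_mulVec_self_le (W 0) v
      rwa [hv, mul_zero] at this ⊢
    · set ρ := (W 0 *ᵥ v) ⬝ᵥ (W 0 *ᵥ v) / (v ⬝ᵥ v) with hρ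
      rw [← div_le_iff₀ hv, ← hρ]
      by_contra! hlt
      have h₁ := h.pow_mul_le_dotProduct_prodTo hδ (ρ := ρ)
        (by rw [hρ, div_mul_cancel₀ _ hv.ne']) (by linarith) le_rfl
      have h₂ := le_of_mul_le_mul_right
        (h₁.trans (dotProduct_mulVec_self_le (prodTo W n) v)) hv
      have h₃ : R ^ n < (ρ - n * δ) ^ n := pow_lt_pow_left₀ (by linarith) hR0 hn
      linarith
  have hk' := h.specNorm_sq_le_first hδ hk
  have : (k : ℝ) * δ ≤ n * δ :=
    mul_le_mul_of_nonneg_right (by exact_mod_cast hk.le) hδ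
  linarith

lemma pow_le_pow_add_mul_pow {x y δ : ℝ} (hx : 0 ≤ x) (hy : 0 ≤ y) (hxy : x ≤ y + δ)
    (hδ : 0 ≤ δ) (k : ℕ) : x ^ (k + 1) ≤ y ^ (k + 1) + (k + 1) * δ * x ^ k := by
  rcases le_total x y with h | h
  · have := pow_le_pow_left₀ hx h (k + 1)
    have : 0 ≤ ((k : ℝ) + 1) * δ * x ^ k := by positivity
    linarith
  induction k with
  | zero => simpa using hxy
  | succ k ih =>
    have h₁ : x ^ (k + 1) * x ≤ x ^ (k + 1) * (y + δ) :=
      mul_le_mul_of_nonneg_left hxy (by positivity)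
    have h₂ := mul_le_mul_of_nonneg_left ih hy
    have h₃ : y * (((k : ℝ) + 1) * δ * x ^ k) ≤ x * ((k + 1) * δ * x ^ k) :=
      mul_le_mul_of_nonneg_right h (by positivity)
    push_cast
    rw [pow_succ x (k + 1), pow_succ' y (k + 1)]
    rw [pow_succ] at *
    nlinarith

/-- In a balanced network, the spectral norms of `n - 2` layers are controlled by that of the
end-to-end matrix. -/
lemma IsBalanced.pow_le_rpow_add {ε : ℝ} (h : IsBalanced n W (ε ^ 2)) (hε : 0 ≤ ε) (hn : 2 ≤ n)
    {k : ℕ} (hk : k < n) {m : ℝ} (hm : 1 ≤ m) (hkm : specNorm (W k) ≤ m) :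
    specNorm (W k) ^ (n - 2) ≤ specNorm (prodTo W n) ^ (1 - 2 / (n : ℝ)) +
      (4 * (n : ℝ)) ^ (1 - 2 / (n : ℝ)) * m ^ (2 * (n - 2)) * ε ^ (1 - 2 / (n : ℝ)) := by
  have hn0 : (0 : ℝ) < n := by exact_mod_cast (by omega : 0 < n)
  have hn2 : (2 : ℝ) ≤ n := by exact_mod_cast hn
  set σ := specNorm (prodTo W n)
  set a := specNorm (W k)
  have hσ : 0 ≤ σ := specNorm_nonneg _
  have ha : 0 ≤ a := specNorm_nonneg _
  have hm0 : 0 ≤ m := zero_le_one.trans hm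
  set R := (σ ^ 2) ^ ((n : ℝ)⁻¹) with hR
  have hR0 : 0 ≤ R := by positivity
  have hRn : R ^ n = σ ^ 2 := Real.rpow_inv_natCast_pow (by positivity) (by omega)
  have ha2 : a ^ 2 ≤ R + 2 * n * ε ^ 2 :=
    h.specNorm_sq_le_add (sq_nonneg ε) (by omega) hR0 hRn.ge hk
  have key : a ^ n ≤ σ + 4 * n * ε * m ^ (2 * n) := by
    obtain ⟨l, rfl⟩ : ∃ l, n = l + 1 := ⟨n - 1, by omega⟩
    have h₁ := pow_le_pow_add_mul_pow (sq_nonneg a) hR0 ha2 (by positivity) l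
    rw [hRn] at h₁
    refine le_of_sq_le_sq ?_ (by positivity)
    have h₂ : (a ^ 2) ^ l ≤ (m ^ (2 * (l + 1))) ^ 2 := by
      rw [← pow_mul, ← pow_mul]
      exact (pow_le_pow_left₀ ha hkm _).trans (pow_le_pow_right₀ hm (by omega))
    have h₃ := mul_le_mul_of_nonneg_left h₂
      (show 0 ≤ ((l : ℝ) + 1) * (2 * ((l + 1 : ℕ) : ℝ) * ε ^ 2) by positivity)
    have h₄ : 0 ≤ σ * (((l : ℝ) + 1) * ε * m ^ (2 * (l + 1))) := by positivity
    have h₅ : 0 ≤ (((l : ℝ) + 1) * ε * m ^ (2 * (l + 1))) ^ 2 := by positivity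
    rw [← pow_mul, mul_comm 2 (l + 1), pow_mul] at h₁
    push_cast at *
    linarith
  have hα0 : 0 ≤ 1 - 2 / (n : ℝ) := by
    rw [sub_nonneg, div_le_one hn0]; exact hn2
  have hα1 : 1 - 2 / (n : ℝ) ≤ 1 := by
    have : 0 ≤ 2 / (n : ℝ) := by positivity
    linarith
  have hnα : (n : ℝ) * (1 - 2 / (n : ℝ)) = ((n - 2 : ℕ) : ℝ) := by
    rw [Nat.cast_sub hn]; field_simp; norm_num
  have e₁ : a ^ (n - 2) = (a ^ n) ^ (1 - 2 / (n : ℝ)) := by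
    rw [← Real.rpow_natCast_mul ha, hnα, Real.rpow_natCast]
  have e₂ : (m ^ (2 * n)) ^ (1 - 2 / (n : ℝ)) = m ^ (2 * (n - 2)) := by
    rw [pow_mul, pow_mul, ← Real.rpow_natCast_mul (by positivity), hnα, Real.rpow_natCast]
  rw [e₁]
  refine (Real.rpow_le_rpow (by positivity) key hα0).trans
    ((Real.rpow_add_le_add_rpow hσ (by positivity) hα0 hα1).trans_eq ?_)
  rw [Real.mul_rpow (by positivity) (by positivity), Real.mul_rpow (by positivity) hε, e₂]
  ring

end Balanced

section SecondOrder

lemma second_deriv_nonneg_of_min {k k' : ℝ → ℝ} {c : ℝ} (hk : ∀ t, HasDerivAt k (k' t) t)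
    (hk' : HasDerivAt k' c 0) (hmin : ∀ t, k 0 ≤ k t) : 0 ≤ c := by
  by_contra! hc
  have hd : deriv k = k' := funext fun t => (hk t).deriv
  have hmin0 : IsLocalMin k 0 := Filter.Eventually.of_forall hmin
  have hmax : IsLocalMax k 0 := isLocalMax_of_deriv_deriv_neg (by rwa [hd, hk'.deriv])
    hmin0.deriv_eq_zero (hk 0).continuousAt
  have hconst : k =ᶠ[nhds 0] fun _ => k 0 :=
    Filter.Eventually.mono hmax fun t ht => le_antisymm ht (hmin t)
  have h0 : k' =ᶠ[nhds 0] fun _ => 0 := by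
    simpa only [hd, deriv_const'] using hconst.deriv
  have := (hk'.congr_of_eventuallyEq h0.symm).unique (hasDerivAt_const (0 : ℝ) (0 : ℝ))
  exact hc.ne this

variable {E : Type*} [NormedAddCommGroup E] [InnerProductSpace ℝ E] [CompleteSpace E]

lemma hasDerivAt_line {f : E → ℝ} (hf : Differentiable ℝ f) (x v : E) (t : ℝ) :
    HasDerivAt (fun s : ℝ => f (x + s • v)) ⟪gradient f (x + t • v), v⟫ t := by
  have hl : HasDerivAt (fun s : ℝ => x + s • v) v t := by
    simpa using ((hasDerivAt_id t).smul_const v).const_add x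
  rw [inner_gradient_left]
  exact (hf (x + t • v)).hasFDerivAt.comp_hasDerivAt t hl

lemma hasDerivAt_inner_gradient_line {f : E → ℝ} (hf : ContDiff ℝ 2 f) (x v : E) :
    HasDerivAt (fun s : ℝ => ⟪gradient f (x + s • v), v⟫) (hessQ f x v) 0 := by
  have hl : HasDerivAt (fun s : ℝ => x + s • v) v 0 := by
    simpa using ((hasDerivAt_id (0 : ℝ)).smul_const v).const_add x
  have hg : Differentiable ℝ (gradient f) := by
    have h₁ : Differentiable ℝ (fderiv ℝ f) :=
      (hf.fderiv_right (m := 1) (by norm_num)).differentiable one_ne_zero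
    exact (InnerProductSpace.toDual ℝ E).symm.toContinuousLinearEquiv.differentiable.comp h₁
  have hgx : HasFDerivAt (gradient f) (fderiv ℝ (gradient f) x) (x + (0 : ℝ) • v) := by
    simpa using (hg x).hasFDerivAt
  have h := (hgx.comp_hasDerivAt (0 : ℝ) hl).inner ℝ (hasDerivAt_const (0 : ℝ) v)
  refine h.congr_deriv ?_
  rw [inner_zero_right, zero_add, hessQ, real_inner_comm]

lemma ConvexOn.add_inner_gradient_le {f : E → ℝ} (hf : ConvexOn ℝ Set.univ f)
    (hd : Differentiable ℝ f) (x y : E) : f x + ⟪gradient f x, y - x⟫ ≤ f y := by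
  have hc : ConvexOn ℝ Set.univ (fun t : ℝ => f (x + t • (y - x))) := by
    have := hf.comp_affineMap (AffineMap.lineMap (k := ℝ) x y)
    refine this.congr fun t _ => ?_
    simp [AffineMap.lineMap_apply, add_comm]
  have h := hc.le_slope_of_hasDerivAt (Set.mem_univ 0) (Set.mem_univ 1) zero_lt_one
    (hasDerivAt_line hd x (y - x) 0)
  simp only [slope_def_field, zero_smul, add_zero, one_smul, add_sub_cancel, sub_zero,
    div_one] at h
  linarith

end SecondOrder

section Loss

/-- The linear map `w ↦ mulVecE (toMat w) x`. -/
def applyLin (p q : ℕ) (x : EuclideanSpace ℝ (Fin q)) :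
    MatE p q →ₗ[ℝ] EuclideanSpace ℝ (Fin p) where
  toFun w := mulVecE (toMat w) x
  map_add' w w' := by
    ext i
    simp [mulVecE, toMat, Matrix.mulVec, dotProduct, add_mul, Finset.sum_add_distrib]
  map_smul' a w := by
    ext i
    simp [mulVecE, toMat, Matrix.mulVec, dotProduct, Finset.mul_sum, mul_assoc]

variable {Y : Type*} {s n : ℕ} {dims : ℕ → ℕ}
  {loss : EuclideanSpace ℝ (Fin (dims n)) → Y → ℝ}
  {x : Fin s → EuclideanSpace ℝ (Fin (dims 0))} {y : Fin s → Y}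

lemma convexOn_phiE (hconv : ∀ yy : Y, ConvexOn ℝ Set.univ (fun v => loss v yy)) :
    ConvexOn ℝ Set.univ (phiE n dims loss x y) := by
  have h : ∀ i, ConvexOn ℝ Set.univ
      (fun w : MatE (dims n) (dims 0) => loss (mulVecE (toMat w) (x i)) (y i)) := fun i =>
    (hconv (y i)).comp_linearMap (applyLin (dims n) (dims 0) (x i))
  have hsum : ∀ t : Finset (Fin s), ConvexOn ℝ Set.univ
      (fun w : MatE (dims n) (dims 0) => ∑ i ∈ t, loss (mulVecE (toMat w) (x i)) (y i)) := by
    intro t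
    induction t using Finset.induction_on with
    | empty => simpa using convexOn_const (0 : ℝ) convex_univ
    | insert i t hi ih =>
      simp only [Finset.sum_insert hi]
      exact (h i).add ih
  exact (hsum Finset.univ).smul (by positivity : (0 : ℝ) ≤ 1 / (s : ℝ))

lemma contDiff_phiE (hsm : ∀ yy : Y, ContDiff ℝ 2 (fun v => loss v yy)) :
    ContDiff ℝ 2 (phiE n dims loss x y) := by
  refine contDiff_const.mul (ContDiff.sum fun i _ => ?_)
  exact (hsm (y i)).comp
    (LinearMap.toContinuousLinearMap (applyLin (dims n) (dims 0) (x i))).contDiff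

lemma contDiff_ofMat {F : Type*} [NormedAddCommGroup F] [NormedSpace ℝ F] {p q : ℕ}
    {M : F → Matrix (Fin p) (Fin q) ℝ} (h : ∀ i j, ContDiff ℝ 2 fun z => M z i j) :
    ContDiff ℝ 2 fun z => ofMat (M z) :=
  (EuclideanSpace.equiv (Fin p × Fin q) ℝ).symm.contDiff.comp
    (contDiff_pi.2 fun ij => h ij.1 ij.2)

lemma hasDerivAt_ofMat {p q : ℕ} {M : ℝ → Matrix (Fin p) (Fin q) ℝ}
    {M' : Matrix (Fin p) (Fin q) ℝ} {t : ℝ}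
    (h : ∀ i j, HasDerivAt (fun s => M s i j) (M' i j) t) :
    HasDerivAt (fun s => ofMat (M s)) (ofMat M') t :=
  (EuclideanSpace.equiv (Fin p × Fin q) ℝ).symm.hasFDerivAt.comp_hasDerivAt t
    (hasDerivAt_pi.2 fun ij => h ij.1 ij.2)

variable {d : ℕ} {arr : EuclideanSpace ℝ (Fin d) →ₗ[ℝ] WeightFam n dims}

lemma contDiff_segProd (b : ℕ) (i : Fin (dims b)) (j : Fin (dims 0)) :
    ContDiff ℝ 2 fun θ => segProd dims (arr θ) 0 b i j := by
  simp only [segProd_zero_eq_prodTo]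
  induction b with
  | zero => exact contDiff_const
  | succ b ih =>
    simp only [prodTo, Matrix.mul_apply]
    refine ContDiff.sum fun k _ => ContDiff.mul ?_ (ih k)
    by_cases hb : b < n
    · simp only [extendFam_of_lt _ hb]
      exact (LinearMap.toContinuousLinearMap
        (LinearMap.proj (R := ℝ) k ∘ₗ LinearMap.proj (R := ℝ) (φ := fun _ => _ → ℝ) i ∘ₗ
          LinearMap.proj (R := ℝ)
            (φ := fun l : Fin n => Matrix (Fin (dims (l.val + 1))) (Fin (dims l.val)) ℝ)
            ⟨b, hb⟩ ∘ₗ arr)).contDiff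
    · simp only [extendFam_of_not_lt _ hb]
      exact contDiff_const

lemma contDiff_linLoss (hsm : ∀ yy : Y, ContDiff ℝ 2 (fun v => loss v yy)) :
    ContDiff ℝ 2 (linLoss dims loss x y arr) :=
  (contDiff_phiE hsm).comp (contDiff_ofMat (contDiff_segProd n))

lemma segProd_line (θ v : EuclideanSpace ℝ (Fin d)) (t : ℝ) (b : ℕ) :
    segProd dims (arr (θ + t • v)) 0 b =
      prodTo (extendFam (arr θ) + t • extendFam (arr v)) b := by
  rw [segProd_zero_eq_prodTo, map_add, map_smul, extendFam_add_smul]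

lemma linLoss_line (θ v : EuclideanSpace ℝ (Fin d)) (t : ℝ) :
    linLoss dims loss x y arr (θ + t • v) = phiE n dims loss x y
      (ofMat (prodTo (extendFam (arr θ) + t • extendFam (arr v)) n)) := by
  rw [linLoss, segProd_line]

lemma inner_gradient_linLoss_eq_zero (hsm : ∀ yy : Y, ContDiff ℝ 2 (fun v => loss v yy))
    {θ v : EuclideanSpace ℝ (Fin d)}
    (h : prodLin (extendFam (arr θ)) (extendFam (arr v)) n = 0) :
    ⟪gradient (linLoss dims loss x y arr) θ, v⟫ = 0 := by
  have h₁ := hasDerivAt_line ((contDiff_linLoss (x := x) (y := y) (arr := arr) hsm).differentiable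
    two_ne_zero) θ v 0
  have h₂ := ((contDiff_phiE (x := x) (y := y) hsm).differentiable two_ne_zero _).hasFDerivAt
    |>.comp_hasDerivAt (0 : ℝ) (hasDerivAt_ofMat
      (hasDerivAt_prodTo (extendFam (arr θ)) (extendFam (arr v)) 0 n))
  simp only [linLoss_line] at h₁
  have h₃ := h₁.unique h₂
  simpa only [zero_smul, add_zero, h, ofMat_zero, map_zero] using h₃

lemma inner_prodQuad_le_hessQ_linLoss
    (hconv : ∀ yy : Y, ConvexOn ℝ Set.univ (fun v => loss v yy))
    (hsm : ∀ yy : Y, ContDiff ℝ 2 (fun v => loss v yy)) (θ v : EuclideanSpace ℝ (Fin d)) :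
    ⟪gradient (phiE n dims loss x y) (ofMat (segProd dims (arr θ) 0 n)),
      (2 : ℝ) • ofMat (prodQuad (extendFam (arr θ)) (extendFam (arr v)) n)⟫ ≤
      hessQ (linLoss dims loss x y arr) θ v := by
  set W := extendFam (arr θ)
  set V := extendFam (arr v)
  have hf := contDiff_linLoss (x := x) (y := y) (arr := arr) hsm
  rw [segProd_zero_eq_prodTo]
  set G := gradient (phiE n dims loss x y) (ofMat (prodTo W n))
  have hG : ∀ {u : ℝ → MatE (dims n) (dims 0)} {u' : MatE (dims n) (dims 0)} {t : ℝ},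
      HasDerivAt u u' t → HasDerivAt (fun r => ⟪G, u r⟫) ⟪G, u'⟫ t := fun {u u' t} h => by
    simpa using (hasDerivAt_const t G).inner ℝ h
  have h₁ : ∀ t, HasDerivAt
      (fun r : ℝ => linLoss dims loss x y arr (θ + r • v) - ⟪G, ofMat (prodTo (W + r • V) n)⟫)
      (⟪gradient (linLoss dims loss x y arr) (θ + t • v), v⟫ -
        ⟪G, ofMat (prodLin (W + t • V) V n)⟫) t := fun t =>
    (hasDerivAt_line (hf.differentiable two_ne_zero) θ v t).sub
      (hG (hasDerivAt_ofMat (hasDerivAt_prodTo W V t n)))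
  have h₂ := (hasDerivAt_inner_gradient_line hf θ v).sub
    (hG (hasDerivAt_ofMat (M' := (2 : ℝ) • prodQuad (W + (0 : ℝ) • V) V n)
      (hasDerivAt_prodLin W V 0 n)))
  have h₃ := second_deriv_nonneg_of_min h₁ h₂ fun t => by
    have hl : ∀ r : ℝ, linLoss dims loss x y arr (θ + r • v) =
        phiE n dims loss x y (ofMat (prodTo (W + r • V) n)) := linLoss_line θ v
    have hle : phiE n dims loss x y (ofMat (prodTo W n)) +
        ⟪G, ofMat (prodTo (W + t • V) n) - ofMat (prodTo W n)⟫ ≤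
        phiE n dims loss x y (ofMat (prodTo (W + t • V) n)) :=
      (convexOn_phiE hconv).add_inner_gradient_le
        ((contDiff_phiE hsm).differentiable two_ne_zero) _ _
    rw [inner_sub_right] at hle
    simp only [hl]
    simp only [zero_smul, add_zero]
    linarith
  rw [zero_smul, add_zero] at h₃
  exact sub_nonneg.1 h₃

end Loss

section Conservation

variable {n d : ℕ} {dims : ℕ → ℕ} {arr : EuclideanSpace ℝ (Fin d) →ₗ[ℝ] WeightFam n dims}

/-- The generator, on the space of weights, of the change of basis in the hidden layers given by
the square matrices `A`. -/
def gaugeLin (A : ∀ j : ℕ, Matrix (Fin (dims j)) (Fin (dims j)) ℝ) :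
    WeightFam n dims →ₗ[ℝ] WeightFam n dims where
  toFun W j := W j * A j - A (j + 1) * W j
  map_add' W V := by
    funext j
    simp only [Pi.add_apply, Matrix.add_mul, Matrix.mul_add]
    abel
  map_smul' a W := by
    funext j
    simp only [Pi.smul_apply, Matrix.smul_mul, Matrix.mul_smul, smul_sub, RingHom.id_apply]

lemma extendFam_gaugeLin (A : ∀ j : ℕ, Matrix (Fin (dims j)) (Fin (dims j)) ℝ)
    (W : WeightFam n dims) : extendFam (gaugeLin A W) =
      fun j => extendFam W j * A j - A (j + 1) * extendFam W j := by
  funext j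
  by_cases h : j < n <;> simp [extendFam, h, gaugeLin]

lemma sum_mul_eq_trace {p q : ℕ} (A B : Matrix (Fin p) (Fin q) ℝ) :
    ∑ i, ∑ j, A i j * B i j = (Aᵀ * B).trace := by
  simp only [Matrix.trace, Matrix.diag_apply, Matrix.mul_apply, Matrix.transpose_apply]
  exact Finset.sum_comm

lemma trace_transpose_mul_gauge_comm {p q : ℕ} (U W : Matrix (Fin p) (Fin q) ℝ)
    {A : Matrix (Fin q) (Fin q) ℝ} {B : Matrix (Fin p) (Fin p) ℝ} (hA : Aᵀ = A) (hB : Bᵀ = B) :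
    (Uᵀ * (W * A - B * W)).trace = ((U * A - B * U)ᵀ * W).trace := by
  rw [Matrix.mul_sub, Matrix.trace_sub, Matrix.transpose_sub, Matrix.sub_mul, Matrix.trace_sub,
    Matrix.transpose_mul, Matrix.transpose_mul, hA, hB, Matrix.mul_assoc A, Matrix.mul_assoc Uᵀ B,
    Matrix.trace_mul_comm A, Matrix.mul_assoc]

lemma trace_transpose_mul_mul_vecMulVec {p q : ℕ} (M : Matrix (Fin p) (Fin q) ℝ)
    (u : Fin q → ℝ) : (Mᵀ * (M * vecMulVec u u)).trace = (M *ᵥ u) ⬝ᵥ (M *ᵥ u) := by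
  rw [← Matrix.mul_assoc, Matrix.mul_vecMulVec, Matrix.trace_vecMulVec, ← Matrix.mulVec_mulVec,
    Matrix.mulVec_transpose, ← Matrix.dotProduct_mulVec]

lemma trace_transpose_mul_vecMulVec_mul {p q : ℕ} (M : Matrix (Fin p) (Fin q) ℝ)
    (u : Fin p → ℝ) : (Mᵀ * (vecMulVec u u * M)).trace = (Mᵀ *ᵥ u) ⬝ᵥ (Mᵀ *ᵥ u) := by
  rw [← trace_transpose_mul_mul_vecMulVec, Matrix.transpose_transpose, ← Matrix.mul_assoc,
    Matrix.trace_mul_comm]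

lemma transpose_piSingle_vecMulVec (l : ℕ) (u : Fin (dims l) → ℝ) (j : ℕ) :
    ((Pi.single l (vecMulVec u u) : ∀ j : ℕ, Matrix (Fin (dims j)) (Fin (dims j)) ℝ) j)ᵀ =
      (Pi.single l (vecMulVec u u) : ∀ j : ℕ, Matrix (Fin (dims j)) (Fin (dims j)) ℝ) j := by
  rcases eq_or_ne j l with rfl | h
  · rw [Pi.single_eq_same, Matrix.transpose_vecMulVec]
  · rw [Pi.single_eq_of_ne h, Matrix.transpose_zero]

/-- The pairing of the weights with the generator of the change of basis `vecMulVec u u` in one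
hidden layer is the balancedness form of that layer evaluated at `u`. -/
lemma sum_trace_gaugeLin_single (W : WeightFam n dims) {k : ℕ} (hk : k + 1 < n)
    (u : Fin (dims (k + 1)) → ℝ) :
    ∑ j : Fin n, ((W j)ᵀ * gaugeLin (Pi.single (k + 1) (vecMulVec u u)) W j).trace =
      (extendFam W (k + 1) *ᵥ u) ⬝ᵥ (extendFam W (k + 1) *ᵥ u) -
        ((extendFam W k)ᵀ *ᵥ u) ⬝ᵥ ((extendFam W k)ᵀ *ᵥ u) := by
  have hk' : k < n := by omega
  simp only [gaugeLin, LinearMap.coe_mk, AddHom.coe_mk, Matrix.mul_sub, Matrix.trace_sub,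
    Finset.sum_sub_distrib]
  congr 1
  · rw [Finset.sum_eq_single (⟨k + 1, hk⟩ : Fin n), Pi.single_eq_same,
      trace_transpose_mul_mul_vecMulVec, extendFam_of_lt _ hk]
    · intro j _ hj
      rw [Pi.single_eq_of_ne (fun h => hj (Fin.ext h)), Matrix.mul_zero, Matrix.mul_zero,
        Matrix.trace_zero]
    · simp
  · rw [Finset.sum_eq_single (⟨k, hk'⟩ : Fin n), Pi.single_eq_same,
      trace_transpose_mul_vecMulVec_mul, extendFam_of_lt _ hk']
    · intro j _ hj
      rw [Pi.single_eq_of_ne (fun h => hj (Fin.ext (by simpa using h))), Matrix.zero_mul,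
        Matrix.mul_zero, Matrix.trace_zero]
    · simp

variable {Y : Type*} {s : ℕ} {x : Fin s → EuclideanSpace ℝ (Fin (dims 0))} {y : Fin s → Y}
  {loss : EuclideanSpace ℝ (Fin (dims n)) → Y → ℝ}

/-- The balancedness forms of the hidden layers are conserved along gradient flow. -/
lemma balanced_form_const (hsm : ∀ yy : Y, ContDiff ℝ 2 (fun v => loss v yy))
    (harr : Function.Bijective arr)
    (hinner : ∀ u v : EuclideanSpace ℝ (Fin d), ⟪u, v⟫ =
      ∑ j : Fin n, ∑ p : Fin (dims (j.val + 1)), ∑ q : Fin (dims j.val),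
        arr u j p q * arr v j p q)
    {c : ℝ → EuclideanSpace ℝ (Fin d)} {T : ℝ} (hT : 0 ≤ T)
    (hc : ∀ t ∈ Set.Icc (0 : ℝ) T,
      HasDerivWithinAt c (-gradient (linLoss dims loss x y arr) (c t)) (Set.Icc (0 : ℝ) T) t)
    {k : ℕ} (hk : k + 1 < n) (u : Fin (dims (k + 1)) → ℝ) :
    (extendFam (arr (c T)) (k + 1) *ᵥ u) ⬝ᵥ (extendFam (arr (c T)) (k + 1) *ᵥ u) -
        ((extendFam (arr (c T)) k)ᵀ *ᵥ u) ⬝ᵥ ((extendFam (arr (c T)) k)ᵀ *ᵥ u) =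
      (extendFam (arr (c 0)) (k + 1) *ᵥ u) ⬝ᵥ (extendFam (arr (c 0)) (k + 1) *ᵥ u) -
        ((extendFam (arr (c 0)) k)ᵀ *ᵥ u) ⬝ᵥ ((extendFam (arr (c 0)) k)ᵀ *ᵥ u) := by
  set A : ∀ j : ℕ, Matrix (Fin (dims j)) (Fin (dims j)) ℝ :=
    Pi.single (k + 1) (vecMulVec u u) with hA
  have hinner' : ∀ u v : EuclideanSpace ℝ (Fin d), ⟪u, v⟫ =
      ∑ j : Fin n, ((arr u j)ᵀ * arr v j).trace := fun u v => by
    rw [hinner]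
    exact Finset.sum_congr rfl fun j _ => sum_mul_eq_trace _ _
  set e := LinearEquiv.ofBijective arr harr
  set L : EuclideanSpace ℝ (Fin d) →L[ℝ] EuclideanSpace ℝ (Fin d) :=
    LinearMap.toContinuousLinearMap (e.symm.toLinearMap ∘ₗ gaugeLin A ∘ₗ arr)
  have hL : ∀ v, arr (L v) = gaugeLin A (arr v) := fun v => e.apply_symm_apply _
  have hsymm : ∀ v w, ⟪v, L w⟫ = ⟪L v, w⟫ := fun v w => by
    rw [hinner', hinner', hL, hL]
    exact Finset.sum_congr rfl fun j _ => trace_transpose_mul_gauge_comm _ _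
      (transpose_piSingle_vecMulVec _ u _) (transpose_piSingle_vecMulVec _ u _)
  have hform : ∀ v, ⟪v, L v⟫ =
      (extendFam (arr v) (k + 1) *ᵥ u) ⬝ᵥ (extendFam (arr v) (k + 1) *ᵥ u) -
        ((extendFam (arr v) k)ᵀ *ᵥ u) ⬝ᵥ ((extendFam (arr v) k)ᵀ *ᵥ u) := fun v => by
    rw [hinner', hL]
    exact sum_trace_gaugeLin_single (arr v) hk u
  have hstat : ∀ v, ⟪gradient (linLoss dims loss x y arr) v, L v⟫ = 0 := fun v => by
    refine inner_gradient_linLoss_eq_zero hsm ?_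
    rw [hL, extendFam_gaugeLin, prodLin_conj, hA, Pi.single_eq_of_ne (Nat.succ_ne_zero k).symm,
      Pi.single_eq_of_ne hk.ne', Matrix.mul_zero, Matrix.zero_mul, sub_zero]
  have hder : ∀ t ∈ Set.Icc (0 : ℝ) T,
      HasDerivWithinAt (fun r => ⟪c r, L (c r)⟫) 0 (Set.Icc 0 T) t := fun t ht => by
    refine ((hc t ht).inner ℝ
      (L.hasFDerivAt.comp_hasDerivWithinAt t (hc t ht))).congr_deriv ?_
    rw [hsymm, real_inner_comm, inner_neg_left, inner_neg_left, hstat, neg_zero, zero_add,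
      Function.comp_apply, hstat, neg_zero]
  have hconst := constant_of_derivWithin_zero
    (fun t ht => (hder t ht).differentiableWithinAt)
    (fun t ht => (hder t (Set.Ico_subset_Icc_self ht)).derivWithin
      ((uniqueDiffOn_Icc (ht.1.trans_lt ht.2)) t (Set.Ico_subset_Icc_self ht)))
    T (Set.right_mem_Icc.2 hT)
  rw [← hform, ← hform]
  exact hconst

lemma norm_sq_eq_sum_norm_ofMat
    (hinner : ∀ u v : EuclideanSpace ℝ (Fin d), ⟪u, v⟫ =
      ∑ j : Fin n, ∑ p : Fin (dims (j.val + 1)), ∑ q : Fin (dims j.val),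
        arr u j p q * arr v j p q) (v : EuclideanSpace ℝ (Fin d)) :
    ‖v‖ ^ 2 = ∑ j ∈ Finset.range n, ‖ofMat (extendFam (arr v) j)‖ ^ 2 := by
  rw [← real_inner_self_eq_norm_sq, hinner, Finset.sum_range]
  refine Finset.sum_congr rfl fun j _ => ?_
  rw [norm_ofMat_sq, extendFam_of_lt _ j.isLt]
  simp only [sq]

lemma isBalanced_of_gradientFlow (hsm : ∀ yy : Y, ContDiff ℝ 2 (fun v => loss v yy))
    (harr : Function.Bijective arr)
    (hinner : ∀ u v : EuclideanSpace ℝ (Fin d), ⟪u, v⟫ =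
      ∑ j : Fin n, ∑ p : Fin (dims (j.val + 1)), ∑ q : Fin (dims j.val),
        arr u j p q * arr v j p q)
    {c : ℝ → EuclideanSpace ℝ (Fin d)} {T : ℝ} (hT : 0 ≤ T)
    (hc : ∀ t ∈ Set.Icc (0 : ℝ) T,
      HasDerivWithinAt c (-gradient (linLoss dims loss x y arr) (c t)) (Set.Icc (0 : ℝ) T) t)
    {ε : ℝ} (hε : ‖c 0‖ ≤ ε) : IsBalanced n (extendFam (arr (c T))) (ε ^ 2) := by
  intro k hk u
  rw [balanced_form_const hsm harr hinner hT hc hk u]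
  have hlayer : ∀ j < n, specNorm (extendFam (arr (c 0)) j) ^ 2 ≤ ε ^ 2 := fun j hj =>
    calc specNorm (extendFam (arr (c 0)) j) ^ 2 ≤ ‖ofMat (extendFam (arr (c 0)) j)‖ ^ 2 :=
          pow_le_pow_left₀ (specNorm_nonneg _) (specNorm_le_norm_ofMat _) 2
      _ ≤ ‖c 0‖ ^ 2 := by
          rw [norm_sq_eq_sum_norm_ofMat hinner]
          exact Finset.single_le_sum (f := fun j => ‖ofMat (extendFam (arr (c 0)) j)‖ ^ 2)
            (fun _ _ => sq_nonneg _) (Finset.mem_range.2 hj)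
      _ ≤ ε ^ 2 := pow_le_pow_left₀ (norm_nonneg _) hε 2
  have hu := dotProduct_self_nonneg_real u
  have h₁ := (dotProduct_mulVec_self_le (extendFam (arr (c 0)) (k + 1)) u).trans
    (mul_le_mul_of_nonneg_right (hlayer _ hk) hu)
  have h₂ := (dotProduct_mulVec_self_le (extendFam (arr (c 0)) k)ᵀ u).trans
    (mul_le_mul_of_nonneg_right ((specNorm_transpose _).symm ▸ hlayer k (by omega)) hu)
  exact abs_sub_le_of_nonneg_of_le (dotProduct_self_nonneg_real _) h₁
    (dotProduct_self_nonneg_real _) h₂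

end Conservation

lemma norm_le_sqrt_min_mul_norm {p q : ℕ} (w : MatE p q) :
    ‖w‖ ≤ Real.sqrt (min (q : ℝ) p) * ‖w‖ := by
  rcases p.eq_zero_or_pos with rfl | hp
  · simp [Subsingleton.elim w 0]
  rcases q.eq_zero_or_pos with rfl | hq
  · simp [Subsingleton.elim w 0]
  exact le_mul_of_one_le_left (norm_nonneg w)
    (Real.one_le_sqrt.2 (le_min (by exact_mod_cast hq) (by exact_mod_cast hp)))

lemma four_mul_div_rpow_eq {n : ℝ} (hn : 0 < n) :
    4 * n * (n - 1) / (4 * n) ^ (2 / n) = (n - 1) * (4 * n) ^ (1 - 2 / n) := by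
  rw [Real.rpow_sub (by positivity), Real.rpow_one]
  ring

/-- Proposition 2 of the paper: along gradient flow trajectories of the
training loss of a deep linear network emanating from a point of norm at most
`ε ∈ (0, 1/(2n)]`, the minimal eigenvalue of the Hessian is lower-bounded by
`-(n-1)·√(min{d₀,dₙ})·‖∇φ(W_{n:1})‖_F·‖W_{n:1}‖_sp^{1-2/n} - c·ε^{1-2/n}`. -/
theorem deep_linear_hessian_min_eig_along_gradient_flow {n d : ℕ} (hn : 2 ≤ n)
    (dims : ℕ → ℕ)
    {Y : Type*} (s : ℕ) (hs : 0 < s)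
    (x : Fin s → EuclideanSpace ℝ (Fin (dims 0))) (y : Fin s → Y)
    (loss : EuclideanSpace ℝ (Fin (dims n)) → Y → ℝ)
    (hconv : ∀ yy : Y, ConvexOn ℝ Set.univ (fun v => loss v yy))
    (hsm : ∀ yy : Y, ContDiff ℝ 2 (fun v => loss v yy))
    (arr : EuclideanSpace ℝ (Fin d) →ₗ[ℝ] WeightFam n dims)
    (harr : Function.Bijective arr)
    (hinner : ∀ u v : EuclideanSpace ℝ (Fin d), ⟪u, v⟫ =
      ∑ j : Fin n, ∑ p : Fin (dims (j.val + 1)), ∑ q : Fin (dims j.val),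
        arr u j p q * arr v j p q)
    (ε : ℝ) (hε0 : 0 < ε) (hε1 : ε ≤ 1 / (2 * (n : ℝ)))
    (θs : EuclideanSpace ℝ (Fin d)) (hθs : ‖θs‖ ≤ ε)
    (c : ℝ → EuclideanSpace ℝ (Fin d)) (hc0 : c 0 = θs)
    (T : ℝ) (hT : 0 ≤ T)
    (hc : ∀ t ∈ Set.Icc (0 : ℝ) T,
      HasDerivWithinAt c (-gradient (linLoss dims loss x y arr) (c t))
        (Set.Icc (0 : ℝ) T) t)
    (θ : EuclideanSpace ℝ (Fin d)) (hθ : θ = c T) :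
    ∀ v : EuclideanSpace ℝ (Fin d),
      (-(((n : ℝ) - 1) * Real.sqrt (min (dims 0) (dims n)) *
          ‖gradient (phiE n dims loss x y) (ofMat (segProd dims (arr θ) 0 n))‖ *
          specNorm (segProd dims (arr θ) 0 n) ^ (1 - 2 / (n : ℝ))) -
        (4 * (n : ℝ) * ((n : ℝ) - 1) / (4 * (n : ℝ)) ^ (2 / (n : ℝ))) *
          Real.sqrt (min (dims 0) (dims n)) *
          ‖gradient (phiE n dims loss x y) (ofMat (segProd dims (arr θ) 0 n))‖ *
          (max 1 (sSup {r : ℝ | ∃ j : Fin n, r = specNorm (arr θ j)})) ^ (2 * (n - 2)) *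
          ε ^ (1 - 2 / (n : ℝ))) * ‖v‖ ^ 2 ≤
      hessQ (linLoss dims loss x y arr) θ v := by
  intro v
  have hn0 : 0 < n := by omega
  have : Nonempty (Fin n) := ⟨⟨0, hn0⟩⟩
  have hbal : IsBalanced n (extendFam (arr θ)) (ε ^ 2) := by
    rw [hθ]
    exact isBalanced_of_gradientFlow hsm harr hinner hT hc (hc0.symm ▸ hθs)
  obtain ⟨k, hk⟩ := Finite.exists_max fun j : Fin n => specNorm (arr θ j)
  set a := specNorm (arr θ k) with ha
  have ha0 : 0 ≤ a := specNorm_nonneg _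
  have hle : ∀ j, specNorm (extendFam (arr θ) j) ≤ a := fun j => by
    by_cases hj : j < n
    · rw [extendFam_of_lt _ hj]
      exact hk ⟨j, hj⟩
    · rw [extendFam_of_not_lt _ hj]
      refine (specNorm_le_norm_ofMat _).trans ?_
      rwa [ofMat_zero, norm_zero]
  set m := max 1 (sSup {r : ℝ | ∃ j : Fin n, r = specNorm (arr θ j)})
  have ham : a ≤ m := le_max_of_le_right
    (le_csSup ⟨a, by rintro r ⟨j, rfl⟩; exact hk j⟩ ⟨k, rfl⟩)
  have hW : extendFam (arr θ) k = arr θ k := extendFam_of_lt _ k.isLt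
  have hpow := hbal.pow_le_rpow_add hε0.le hn k.isLt (le_max_left _ _ : 1 ≤ m)
    (by rw [hW]; exact ham)
  rw [hW, ← ha, ← segProd_zero_eq_prodTo] at hpow
  have hhess := inner_prodQuad_le_hessQ_linLoss (arr := arr) (x := x) (y := y) hconv hsm θ v
  set g := gradient (phiE n dims loss x y) (ofMat (segProd dims (arr θ) 0 n))
  set Q := ofMat (prodQuad (extendFam (arr θ)) (extendFam (arr v)) n)
  have hQ : 2 * ‖Q‖ ≤ a ^ (n - 2) * (((n : ℝ) - 1) * ‖v‖ ^ 2) := by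
    rw [norm_sq_eq_sum_norm_ofMat hinner]
    exact two_mul_norm_prodQuad_le_sum_sq hle _ n
  have hCS : -(‖g‖ * (2 * ‖Q‖)) ≤ ⟪g, (2 : ℝ) • Q⟫ := by
    have h := neg_le_of_abs_le (abs_real_inner_le_norm g ((2 : ℝ) • Q))
    rwa [norm_smul, Real.norm_ofNat] at h
  refine le_trans ?_ (hCS.trans hhess)
  have hn1 : (0 : ℝ) ≤ (n : ℝ) - 1 := sub_nonneg.2 (by exact_mod_cast hn0)
  have hκ := norm_le_sqrt_min_mul_norm g
  set κ := Real.sqrt (min (dims 0 : ℝ) (dims n))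
  have hbound : ‖g‖ * (2 * ‖Q‖) ≤ κ * ‖g‖ *
      ((specNorm (segProd dims (arr θ) 0 n) ^ (1 - 2 / (n : ℝ)) +
        (4 * (n : ℝ)) ^ (1 - 2 / (n : ℝ)) * m ^ (2 * (n - 2)) * ε ^ (1 - 2 / (n : ℝ))) *
          (((n : ℝ) - 1) * ‖v‖ ^ 2)) :=
    mul_le_mul hκ (hQ.trans (mul_le_mul_of_nonneg_right hpow (by positivity))) (by positivity)
      (by positivity)
  rw [four_mul_div_rpow_eq (by exact_mod_cast hn0)]
  refine (le_of_eq ?_).trans (neg_le_neg hbound)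
  ring
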